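/- Let d ≥ 3, let S ⊆ {1,…,d} with 2 ≤ |S| ≤ d-1, let η ∈ [0,1/2), and let ε ∈ (0,1). Let D' = (1/2)·D_{1-2/d} + (1/2)·Unif({-1,1}^d), and draw m i.i.d. pairs (x^{(j)}, y^{(j)}) where x^{(j)} ∼ D' and y^{(j)} = ξ^{(j)}·χ_S(x^{(j)}) with ξ^{(j)} ∈ {-1,1} independent of everything else and P(ξ^{(j)}=1)=1-η. Define the empirical correlations T̂_i = (1/m)∑_{j=1}^m y^{(j)} x_i^{(j)} and the estimated support Ŝ = { i : T̂_i > (min_{l} T̂_l + max_{l} T̂_l)/2 }. Set Δ = (1/2)(1-2η)(1-2/d)^{|S|-1}·(1-(1-2/d)²). If m ≥ 512·Δ^{-2}·log(2d/ε), then P(Ŝ = S) ≥ 1 - ε. -/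

import Mathlib

open Finset

/-- The ±1 real value of a Boolean coordinate of the hypercube `{-1,1}^d`. -/
noncomputable def sgn (b : Bool) : ℝ := if b then 1 else -1

/-- Weight of a point `x` under the product probability measure `D_μ` on `{-1,1}^d` whose
coordinates are i.i.d. with value `1` having probability `(1+μ)/2` (mean `μ`).
`wMu d 0` is the uniform distribution on the hypercube. -/
noncomputable def wMu (d : ℕ) (μ : ℝ) (x : Fin d → Bool) : ℝ :=
  ∏ i, (if x i then (1 + μ) / 2 else (1 - μ) / 2)

/-- The parity function `χ_S(x) = ∏_{i ∈ S} x_i` on the hypercube `{-1,1}^d`. -/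
noncomputable def chi (d : ℕ) (S : Finset (Fin d)) (x : Fin d → Bool) : ℝ :=
  ∏ i ∈ S, sgn (x i)

/-- Weight of `x` under the mixture `D' = (1/2)·D_{1-2/d} + (1/2)·Unif({-1,1}^d)`. -/
noncomputable def wMix (d : ℕ) (x : Fin d → Bool) : ℝ :=
  (1 / 2) * wMu d (1 - 2 / (d : ℝ)) x + (1 / 2) * wMu d 0 x

/-- Weight of an i.i.d. sample `ω` of `m` pairs, where the `j`-th pair consists of an
input `(ω j).1 ∼ D'` and a noise sign `(ω j).2` taking value `+1` (i.e. `true`) with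
probability `1-η` and `-1` (i.e. `false`) with probability `η`, all independent. -/
noncomputable def sampW (d m : ℕ) (η : ℝ) (ω : Fin m → (Fin d → Bool) × Bool) : ℝ :=
  ∏ j, (wMix d (ω j).1 * (if (ω j).2 then 1 - η else η))

/-- The empirical correlation `T̂_i = (1/m) ∑_j y⁽ʲ⁾ x_i⁽ʲ⁾` where `y⁽ʲ⁾ = ξ⁽ʲ⁾·χ_S(x⁽ʲ⁾)`. -/
noncomputable def That (d m : ℕ) (S : Finset (Fin d))
    (ω : Fin m → (Fin d → Bool) × Bool) (i : Fin d) : ℝ :=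
  (1 / (m : ℝ)) * ∑ j, sgn (ω j).2 * chi d S (ω j).1 * sgn ((ω j).1 i)

open Classical in
/-- The estimated support `Ŝ = { i : T̂_i > (min_l T̂_l + max_l T̂_l)/2 }`. -/
noncomputable def Shat (d m : ℕ) (hd : 0 < d) (S : Finset (Fin d))
    (ω : Fin m → (Fin d → Bool) × Bool) : Finset (Fin d) :=
  Finset.univ.filter (fun i =>
    (Finset.univ.inf' (Finset.univ_nonempty_iff.mpr (Fin.pos_iff_nonempty.mp hd))
        (That d m S ω)
      + Finset.univ.sup' (Finset.univ_nonempty_iff.mpr (Fin.pos_iff_nonempty.mp hd))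
        (That d m S ω)) / 2 < That d m S ω i)

lemma abs_sgn (b : Bool) : |sgn b| = 1 := by
  cases b <;> simp [sgn]

lemma sgn_mul_self (b : Bool) : sgn b * sgn b = 1 := by
  cases b <;> simp [sgn]

lemma abs_chi (d : ℕ) (S : Finset (Fin d)) (x : Fin d → Bool) : |chi d S x| = 1 := by
  simp [chi, Finset.abs_prod, abs_sgn]

lemma chi_empty (d : ℕ) (x : Fin d → Bool) : chi d ∅ x = 1 := by
  simp [chi]

lemma chi_mul_sgn_of_mem {d : ℕ} {S : Finset (Fin d)} {i : Fin d} (hi : i ∈ S)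
    (x : Fin d → Bool) : chi d S x * sgn (x i) = chi d (S.erase i) x := by
  unfold chi
  rw [← Finset.mul_prod_erase S _ hi, mul_right_comm, sgn_mul_self, one_mul]

lemma chi_mul_sgn_of_notMem {d : ℕ} {S : Finset (Fin d)} {i : Fin d} (hi : i ∉ S)
    (x : Fin d → Bool) : chi d S x * sgn (x i) = chi d (insert i S) x := by
  unfold chi
  rw [Finset.prod_insert hi, mul_comm]

/-- The mean of a parity under `D_μ`. -/
lemma sum_wMu_mul_chi (d : ℕ) (μ : ℝ) (T : Finset (Fin d)) :
    ∑ x, wMu d μ x * chi d T x = μ ^ T.card := by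
  have h : ∀ x : Fin d → Bool, wMu d μ x * chi d T x =
      ∏ i, ((if x i then (1 + μ) / 2 else (1 - μ) / 2) * (if i ∈ T then sgn (x i) else 1)) := by
    intro x
    rw [Finset.prod_mul_distrib, Finset.prod_ite_mem, Finset.univ_inter]
    rfl
  simp_rw [h]
  rw [← Fintype.piFinset_univ, ← Finset.prod_univ_sum (fun _ => Finset.univ)
    (fun i b => (if b then (1 + μ) / 2 else (1 - μ) / 2) * (if i ∈ T then sgn b else 1))]
  have h2 : ∀ i : Fin d, ∑ b : Bool, (if b then (1 + μ) / 2 else (1 - μ) / 2)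
      * (if i ∈ T then sgn b else 1) = if i ∈ T then μ else 1 := by
    intro i
    by_cases hi : i ∈ T <;> simp [hi, sgn] <;> ring
  simp_rw [h2]
  rw [Finset.prod_ite_mem, Finset.univ_inter, Finset.prod_const]

lemma wMu_nonneg (d : ℕ) {μ : ℝ} (h : |μ| ≤ 1) (x : Fin d → Bool) : 0 ≤ wMu d μ x := by
  obtain ⟨h1, h2⟩ := abs_le.mp h
  refine Finset.prod_nonneg fun i _ => ?_
  split_ifs <;> linarith

lemma sum_wMix_mul_chi (d : ℕ) (T : Finset (Fin d)) :
    ∑ x, wMix d x * chi d T x = (1 / 2) * (1 - 2 / (d : ℝ)) ^ T.card + (1 / 2) * 0 ^ T.card := by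
  rw [← sum_wMu_mul_chi, ← sum_wMu_mul_chi, Finset.mul_sum, Finset.mul_sum,
    ← Finset.sum_add_distrib]
  refine Finset.sum_congr rfl fun x _ => ?_
  unfold wMix
  ring

/-- Weight of a single pair of input and noise sign. -/
noncomputable def pairW (d : ℕ) (η : ℝ) (p : (Fin d → Bool) × Bool) : ℝ :=
  wMix d p.1 * (if p.2 then 1 - η else η)

lemma sum_pairW_mul_chi (d : ℕ) (η : ℝ) {T : Finset (Fin d)} (hT : T.Nonempty) :
    ∑ p, pairW d η p * (sgn p.2 * chi d T p.1)
      = (1 / 2) * (1 - 2 * η) * (1 - 2 / (d : ℝ)) ^ T.card := by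
  have h := sum_wMix_mul_chi d T
  rw [zero_pow hT.card_ne_zero, mul_zero, add_zero] at h
  rw [mul_right_comm, ← h, Fintype.sum_prod_type, Finset.sum_mul]
  refine Finset.sum_congr rfl fun x _ => ?_
  simp [pairW, sgn]
  ring

lemma sum_pairW (d : ℕ) (η : ℝ) : ∑ p, pairW d η p = 1 := by
  have h := sum_wMix_mul_chi d ∅
  simp only [chi_empty, mul_one, Finset.card_empty, pow_zero] at h
  rw [Fintype.sum_prod_type]
  calc _ = ∑ x, wMix d x := Finset.sum_congr rfl fun x _ => by simp [pairW]; ring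
    _ = 1 := by rw [h]; norm_num

lemma pairW_nonneg {d : ℕ} (hd : 0 < d) {η : ℝ} (h0 : 0 ≤ η) (h1 : η ≤ 1)
    (p : (Fin d → Bool) × Bool) : 0 ≤ pairW d η p := by
  have hd' : (1 : ℝ) ≤ d := by exact_mod_cast hd
  have hq : 2 / (d : ℝ) ≤ 2 := by rw [div_le_iff₀ (by linarith)]; linarith
  have hq0 : 0 ≤ 2 / (d : ℝ) := by positivity
  have hw : 0 ≤ wMix d p.1 := by
    have := wMu_nonneg d (μ := 1 - 2 / (d : ℝ)) (abs_le.mpr ⟨by linarith, by linarith⟩) p.1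
    have := wMu_nonneg d (μ := 0) (by simp) p.1
    unfold wMix
    linarith
  refine mul_nonneg hw ?_
  split_ifs <;> linarith

/-- Expectations of products of i.i.d. quantities factor. -/
lemma sum_prod_eq_pow {α : Type*} [Fintype α] (m : ℕ) (g : α → ℝ) :
    ∑ ω : Fin m → α, ∏ j, g (ω j) = (∑ a, g a) ^ m := by
  classical
  rw [← Fintype.piFinset_univ, ← Finset.prod_univ_sum (fun _ => Finset.univ) (fun _ a => g a)]
  simp

/-- One-sided Chernoff bound for i.i.d. averages of a function bounded by one. -/
lemma sum_filter_le_exp {α : Type*} [Fintype α] {w f : α → ℝ} (hw : ∀ a, 0 ≤ w a)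
    (hw1 : ∑ a, w a = 1) (hf : ∀ a, |f a| ≤ 1) (m : ℕ) {s : ℝ} (hs : 0 ≤ s) (hs4 : s ≤ 4) :
    ∑ ω : Fin m → α with m * s ≤ ∑ j, (f (ω j) - ∑ a, w a * f a), ∏ j, w (ω j)
      ≤ Real.exp (-(m * s ^ 2 / 16)) := by
  set e := ∑ a, w a * f a with he
  have he1 : |e| ≤ 1 := by
    calc |e| ≤ ∑ a, |w a * f a| := Finset.abs_sum_le_sum_abs _ _
      _ ≤ ∑ a, w a := Finset.sum_le_sum fun a _ => by
          rw [abs_mul, abs_of_nonneg (hw a)]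
          exact mul_le_of_le_one_right (hw a) (hf a)
      _ = 1 := hw1
  have hmgf : ∑ a, w a * Real.exp (s / 8 * (f a - e)) ≤ Real.exp (s ^ 2 / 16) := by
    have hpt : ∀ a, Real.exp (s / 8 * (f a - e)) ≤ 1 + s / 8 * (f a - e) + s ^ 2 / 16 := by
      intro a
      have h2 : |f a - e| ≤ 2 := by
        have := abs_sub (f a) e
        linarith [hf a]
      have h1 : |s / 8 * (f a - e)| ≤ 1 := by
        rw [abs_mul, abs_of_nonneg (by positivity)]
        nlinarith [abs_nonneg (f a - e)]
      have h3 := (abs_le.mp (Real.abs_exp_sub_one_sub_id_le h1)).2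
      have h4 : (s / 8 * (f a - e)) ^ 2 ≤ s ^ 2 / 16 := by
        have : (f a - e) ^ 2 ≤ 2 ^ 2 := sq_le_sq' (abs_le.mp h2).1 (abs_le.mp h2).2
        nlinarith [sq_nonneg s]
      linarith
    calc _ ≤ ∑ a, w a * (1 + s / 8 * (f a - e) + s ^ 2 / 16) :=
          Finset.sum_le_sum fun a _ => mul_le_mul_of_nonneg_left (hpt a) (hw a)
      _ = ∑ a, ((1 - s / 8 * e + s ^ 2 / 16) * w a + s / 8 * (w a * f a)) :=
          Finset.sum_congr rfl fun a _ => by ring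
      _ = s ^ 2 / 16 + 1 := by
          rw [Finset.sum_add_distrib, ← Finset.mul_sum, ← Finset.mul_sum, hw1, ← he]
          ring
      _ ≤ _ := Real.add_one_le_exp _
  calc _ ≤ ∑ ω : Fin m → α with m * s ≤ ∑ j, (f (ω j) - e),
          Real.exp (-(s / 8 * (m * s))) * ∏ j, (w (ω j) * Real.exp (s / 8 * (f (ω j) - e))) := by
        refine Finset.sum_le_sum fun ω hω => ?_
        have hω' := (Finset.mem_filter.mp hω).2
        rw [Finset.prod_mul_distrib, ← Real.exp_sum, ← Finset.mul_sum, mul_left_comm,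
          ← Real.exp_add]
        refine le_mul_of_one_le_right (Finset.prod_nonneg fun j _ => hw _) ?_
        rw [Real.one_le_exp_iff]
        have := mul_le_mul_of_nonneg_left hω' (by positivity : 0 ≤ s / 8)
        linarith
    _ ≤ ∑ ω : Fin m → α,
          Real.exp (-(s / 8 * (m * s))) * ∏ j, (w (ω j) * Real.exp (s / 8 * (f (ω j) - e))) :=
        Finset.sum_le_sum_of_subset_of_nonneg (Finset.filter_subset _ _) fun ω _ _ =>
          mul_nonneg (Real.exp_pos _).le
            (Finset.prod_nonneg fun j _ => mul_nonneg (hw _) (Real.exp_pos _).le)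
    _ = Real.exp (-(s / 8 * (m * s))) * (∑ a, w a * Real.exp (s / 8 * (f a - e))) ^ m := by
        rw [← Finset.mul_sum, sum_prod_eq_pow m fun a => w a * Real.exp (s / 8 * (f a - e))]
    _ ≤ Real.exp (-(s / 8 * (m * s))) * Real.exp (s ^ 2 / 16) ^ m := by
        gcongr
        exact Finset.sum_nonneg fun a _ => mul_nonneg (hw _) (Real.exp_pos _).le
    _ = _ := by
        rw [← Real.exp_nat_mul, ← Real.exp_add]
        ring_nf

/-- Two-sided Chernoff bound for i.i.d. averages of a function bounded by one. -/
lemma sum_filter_abs_le_exp {α : Type*} [Fintype α] {w f : α → ℝ} (hw : ∀ a, 0 ≤ w a)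
    (hw1 : ∑ a, w a = 1) (hf : ∀ a, |f a| ≤ 1) (m : ℕ) {s : ℝ} (hs : 0 ≤ s) (hs4 : s ≤ 4) :
    ∑ ω : Fin m → α with m * s ≤ |∑ j, (f (ω j) - ∑ a, w a * f a)|, ∏ j, w (ω j)
      ≤ 2 * Real.exp (-(m * s ^ 2 / 16)) := by
  classical
  have h1 := sum_filter_le_exp hw hw1 hf m hs hs4
  have h2 := sum_filter_le_exp (f := fun a => -f a) hw hw1 (by simpa using hf) m hs hs4
  have h3 : ∀ ω : Fin m → α, ∑ j, (-f (ω j) - ∑ a, w a * -f a)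
      = -∑ j, (f (ω j) - ∑ a, w a * f a) := by
    intro ω
    simp only [mul_neg, Finset.sum_neg_distrib, Finset.sum_sub_distrib, Finset.sum_const]
    simp
    ring
  simp only [h3] at h2
  have h4 := Finset.sum_union_inter (f := fun ω : Fin m → α => ∏ j, w (ω j))
    (s₁ := {ω | m * s ≤ ∑ j, (f (ω j) - ∑ a, w a * f a)})
    (s₂ := {ω | m * s ≤ -∑ j, (f (ω j) - ∑ a, w a * f a)})
  rw [← Finset.filter_or] at h4
  simp only [le_abs]
  have h5 := Finset.sum_nonneg (f := fun ω : Fin m → α => ∏ j, w (ω j))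
    (s := Finset.univ.filter (fun ω => m * s ≤ ∑ j, (f (ω j) - ∑ a, w a * f a)) ∩
      Finset.univ.filter (fun ω => m * s ≤ -∑ j, (f (ω j) - ∑ a, w a * f a)))
    fun ω _ => Finset.prod_nonneg fun j _ => hw _
  linarith

/-- Thresholding at the midrange recovers `S` when all values on `S` are close to `a` and all
values off `S` are close to `b < a`. -/
lemma midrange_lt_iff {ι : Type*} [Fintype ι] (hne : (Finset.univ : Finset ι).Nonempty)
    {S : Finset ι} {T : ι → ℝ} {a b r : ℝ} (hS : ∃ i, i ∈ S) (hS' : ∃ i, i ∉ S)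
    (hab : 4 * r ≤ a - b) (hin : ∀ i ∈ S, |T i - a| < r) (hout : ∀ i ∉ S, |T i - b| < r) (i : ι) :
    (Finset.univ.inf' hne T + Finset.univ.sup' hne T) / 2 < T i ↔ i ∈ S := by
  obtain ⟨k, hk⟩ := hS
  obtain ⟨l, hl⟩ := hS'
  have hr : 0 < r := (abs_nonneg _).trans_lt (hin k hk)
  have hk1 := abs_lt.mp (hin k hk)
  have hl1 := abs_lt.mp (hout l hl)
  have hinf : Finset.univ.inf' hne T ≤ T l := Finset.inf'_le _ (Finset.mem_univ l)
  have hsup : T k ≤ Finset.univ.sup' hne T := Finset.le_sup' _ (Finset.mem_univ k)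
  have hinf' : b - r < Finset.univ.inf' hne T := by
    rw [Finset.lt_inf'_iff]
    intro j _
    by_cases hj : j ∈ S
    · linarith [abs_lt.mp (hin j hj)]
    · linarith [abs_lt.mp (hout j hj)]
  have hsup' : Finset.univ.sup' hne T < a + r := by
    rw [Finset.sup'_lt_iff]
    intro j _
    by_cases hj : j ∈ S
    · linarith [abs_lt.mp (hin j hj)]
    · linarith [abs_lt.mp (hout j hj)]
  by_cases hi : i ∈ S
  · have := abs_lt.mp (hin i hi)
    exact iff_of_true (by linarith) hi
  · have := abs_lt.mp (hout i hi)
    exact iff_of_false (by linarith) hi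

/-- The mean of `T̂_i`. -/
noncomputable def meanT (d : ℕ) (η : ℝ) (S : Finset (Fin d)) (i : Fin d) : ℝ :=
  ∑ p, pairW d η p * (sgn p.2 * chi d S p.1 * sgn (p.1 i))

lemma meanT_of_mem {d : ℕ} (η : ℝ) {S : Finset (Fin d)} (hS : 2 ≤ S.card) {i : Fin d}
    (hi : i ∈ S) :
    meanT d η S i = (1 / 2) * (1 - 2 * η) * (1 - 2 / (d : ℝ)) ^ (S.card - 1) := by
  have hc := Finset.card_erase_of_mem hi
  rw [← hc, ← sum_pairW_mul_chi d η (Finset.card_pos.mp (by omega))]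
  simp_rw [meanT, mul_assoc (sgn _), chi_mul_sgn_of_mem hi]

lemma meanT_of_notMem {d : ℕ} (η : ℝ) {S : Finset (Fin d)} {i : Fin d} (hi : i ∉ S) :
    meanT d η S i = (1 / 2) * (1 - 2 * η) * (1 - 2 / (d : ℝ)) ^ (S.card + 1) := by
  rw [← Finset.card_insert_of_notMem hi,
    ← sum_pairW_mul_chi d η (Finset.insert_nonempty i S)]
  simp_rw [meanT, mul_assoc (sgn _), chi_mul_sgn_of_notMem hi]

lemma That_sub_meanT {d m : ℕ} (hm : 0 < m) (η : ℝ) (S : Finset (Fin d))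
    (ω : Fin m → (Fin d → Bool) × Bool) (i : Fin d) :
    ∑ j, (sgn (ω j).2 * chi d S (ω j).1 * sgn ((ω j).1 i) - meanT d η S i)
      = m * (That d m S ω i - meanT d η S i) := by
  have hm' : (m : ℝ) ≠ 0 := by exact_mod_cast hm.ne'
  rw [Finset.sum_sub_distrib, That]
  simp
  field_simp

open Classical in
/-- Support recovery for noisy parities from the shifted training distribution:
if `m ≥ 512·Δ⁻²·log(2d/ε)` with `Δ = (1/2)(1-2η)(1-2/d)^(|S|-1)(1-(1-2/d)²)`, then
drawing `m` i.i.d. pairs `(x⁽ʲ⁾, ξ⁽ʲ⁾)` with `x⁽ʲ⁾ ∼ D' = (1/2)D_{1-2/d} + (1/2)Unif`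
and labels `y⁽ʲ⁾ = ξ⁽ʲ⁾χ_S(x⁽ʲ⁾)`, the estimated support `Ŝ` (built from the empirical
correlations `T̂_i` by thresholding at the midpoint of their min and max) equals `S`
with probability at least `1 - ε`. -/
theorem stmt2 (d : ℕ) (hd : 3 ≤ d) (S : Finset (Fin d)) (hS : 2 ≤ S.card)
    (hS' : S.card < d) (η : ℝ) (hη : η ∈ Set.Ico (0 : ℝ) (1 / 2))
    (ε : ℝ) (hε : ε ∈ Set.Ioo (0 : ℝ) 1) (m : ℕ)
    (hm : (512 : ℝ) *
        ((1 / 2) * (1 - 2 * η) * (1 - 2 / (d : ℝ)) ^ (S.card - 1)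
          * (1 - (1 - 2 / (d : ℝ)) ^ 2))⁻¹ ^ 2 * Real.log (2 * d / ε) ≤ (m : ℝ)) :
    1 - ε ≤
      ∑ ω ∈ Finset.univ.filter
          (fun ω : Fin m → (Fin d → Bool) × Bool =>
            Shat d m (by omega) S ω = S),
        sampW d m η ω := by
  obtain ⟨hη0, hη1⟩ := hη
  obtain ⟨hε0, hε1⟩ := hε
  have hd3 : (3 : ℝ) ≤ d := by exact_mod_cast hd
  have hμ0 : 0 < 1 - 2 / (d : ℝ) := by
    rw [sub_pos, div_lt_one (by linarith)]
    linarith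
  have hμ1 : 1 - 2 / (d : ℝ) < 1 := by
    have : 0 < 2 / (d : ℝ) := by positivity
    linarith
  set μ := 1 - 2 / (d : ℝ) with hμ
  set Δ := (1 / 2) * (1 - 2 * η) * μ ^ (S.card - 1) * (1 - μ ^ 2) with hΔ
  have hsq : μ ^ 2 < 1 := by nlinarith
  have hpow : μ ^ (S.card - 1) ≤ 1 := pow_le_one₀ hμ0.le hμ1.le
  have hpow0 : 0 < μ ^ (S.card - 1) := pow_pos hμ0 _
  have hΔ0 : 0 < Δ := mul_pos (mul_pos (by linarith) hpow0) (by linarith)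
  have hΔ1 : Δ ≤ 1 := by
    have h1 : (1 / 2) * (1 - 2 * η) * μ ^ (S.card - 1) ≤ 1 :=
      mul_le_one₀ (by linarith) hpow0.le hpow
    exact mul_le_one₀ h1 (by linarith) (by nlinarith)
  have hgap : (1 / 2) * (1 - 2 * η) * μ ^ (S.card - 1) - (1 / 2) * (1 - 2 * η) * μ ^ (S.card + 1)
      = Δ := by
    have : S.card + 1 = (S.card - 1) + 2 := by omega
    rw [this, pow_add, hΔ]
    ring
  set q := 2 * (d : ℝ) / ε with hq
  have hq1 : 1 < q := by
    rw [hq, lt_div_iff₀ hε0]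
    linarith
  have hlog : 0 < Real.log q := Real.log_pos hq1
  have hmpos : 0 < m := by
    have : (0 : ℝ) < m := lt_of_lt_of_le (by positivity) hm
    exact_mod_cast this
  have hm0 : (0 : ℝ) < m := by exact_mod_cast hmpos
  have htail : 2 * Real.exp (-(m * (Δ / 4) ^ 2 / 16)) ≤ ε / d := by
    have h1 : 512 * Real.log q ≤ m * Δ ^ 2 := by
      have := mul_le_mul_of_nonneg_right hm (sq_nonneg Δ)
      have h2 : 512 * Δ⁻¹ ^ 2 * Real.log q * Δ ^ 2 = 512 * Real.log q := by
        field_simp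
      linarith
    have h2 : Real.exp (-(m * (Δ / 4) ^ 2 / 16)) ≤ Real.exp (-Real.log q) :=
      Real.exp_le_exp.mpr (by nlinarith)
    rw [Real.exp_neg (Real.log q), Real.exp_log (by linarith)] at h2
    calc _ ≤ 2 * q⁻¹ := by linarith
      _ = ε / d := by rw [hq]; field_simp
  have hw := pairW_nonneg (d := d) (by omega) hη0 (by linarith : η ≤ 1)
  have hWn : ∀ ω : Fin m → (Fin d → Bool) × Bool, 0 ≤ sampW d m η ω :=
    fun ω => Finset.prod_nonneg fun j _ => hw (ω j)
  have hW1 : ∑ ω : Fin m → (Fin d → Bool) × Bool, sampW d m η ω = 1 := by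
    have := sum_prod_eq_pow m (pairW d η)
    rwa [sum_pairW, one_pow] at this
  have hdev : ∀ i : Fin d, ∑ ω : Fin m → (Fin d → Bool) × Bool with
      Δ / 4 ≤ |That d m S ω i - meanT d η S i|, sampW d m η ω ≤ ε / d := by
    intro i
    refine le_trans (le_of_eq ?_) ((sum_filter_abs_le_exp
      (f := fun p : (Fin d → Bool) × Bool => sgn p.2 * chi d S p.1 * sgn (p.1 i))
      hw (sum_pairW d η) (fun p => by simp [abs_mul, abs_sgn, abs_chi]) m
      (s := Δ / 4) (by positivity) (by linarith)).trans htail)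
    refine Finset.sum_congr (Finset.filter_congr fun ω _ => ?_) fun _ _ => rfl
    rw [← meanT, That_sub_meanT hmpos, abs_mul, abs_of_pos hm0, mul_le_mul_iff_right₀ hm0]
  have hgood : ∀ ω : Fin m → (Fin d → Bool) × Bool, ¬ Shat d m (by omega) S ω = S →
      ∃ i, Δ / 4 ≤ |That d m S ω i - meanT d η S i| := by
    intro ω h
    by_contra! hc
    refine h (Finset.ext fun i => ?_)
    rw [Shat, Finset.mem_filter]
    simp only [Finset.mem_univ, true_and]
    refine midrange_lt_iff _ (Finset.card_pos.mp (by omega)) ?_ (by linarith [hgap] :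
      4 * (Δ / 4) ≤ (1 / 2) * (1 - 2 * η) * μ ^ (S.card - 1)
        - (1 / 2) * (1 - 2 * η) * μ ^ (S.card + 1)) ?_ ?_ i
    · by_contra! hall
      rw [Finset.eq_univ_iff_forall.mpr hall, Finset.card_univ, Fintype.card_fin] at hS'
      exact lt_irrefl _ hS'
    · intro k hk
      have := hc k
      rwa [meanT_of_mem η hS hk] at this
    · intro k hk
      have := hc k
      rwa [meanT_of_notMem η hk] at this
  have hbad : ∑ ω : Fin m → (Fin d → Bool) × Bool with ¬ Shat d m (by omega) S ω = S,
      sampW d m η ω ≤ ε := by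
    calc _ ≤ ∑ ω : Fin m → (Fin d → Bool) × Bool, ∑ i : Fin d,
          (if Δ / 4 ≤ |That d m S ω i - meanT d η S i| then sampW d m η ω else 0) := by
          rw [Finset.sum_filter]
          refine Finset.sum_le_sum fun ω _ => ?_
          have hn : ∀ i ∈ (Finset.univ : Finset (Fin d)), 0 ≤
              (if Δ / 4 ≤ |That d m S ω i - meanT d η S i| then sampW d m η ω else 0) :=
            fun i _ => by split_ifs <;> simp [hWn ω]
          by_cases h : Shat d m (by omega) S ω = S
          · rw [if_neg (not_not.mpr h)]
            exact Finset.sum_nonneg hn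
          · rw [if_pos h]
            obtain ⟨i, hi⟩ := hgood ω h
            refine le_trans (le_of_eq ?_) (Finset.single_le_sum hn (Finset.mem_univ i))
            rw [if_pos hi]
      _ = ∑ i : Fin d, ∑ ω : Fin m → (Fin d → Bool) × Bool with
          Δ / 4 ≤ |That d m S ω i - meanT d η S i|, sampW d m η ω := by
          rw [Finset.sum_comm]
          simp_rw [Finset.sum_filter]
      _ ≤ ∑ _i : Fin d, ε / d := Finset.sum_le_sum fun i _ => hdev i
      _ = ε := by
          rw [Finset.sum_const, Finset.card_univ, Fintype.card_fin, nsmul_eq_mul]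
          field_simp
  have hsplit := Finset.sum_filter_add_sum_filter_not Finset.univ
    (fun ω : Fin m → (Fin d → Bool) × Bool => Shat d m (by omega) S ω = S) (sampW d m η)
  rw [hW1] at hsplit
  linarith
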